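/- arXiv:1906.05025 — 3 statements merged into one kernel-verified Lean document; each statement's English description precedes it below -/
import Mathlib

section
/- Let n ≥ 3 be an integer. There exist a real number T* and a function w : ℝ → ℝ which is continuous on [T*, ∞) and twice continuously differentiable on (T*, ∞), such that w''(t) − (n−2)·w'(t) + exp(−2t + exp(w(t))) = 0 and w(t) > 0 for all t > T*, w(T*) = 0, and w(t) − ln(2t + φ(t)) = O(1/t²) as t → ∞ (i.e. there exist C, T > 0 with |w(t) − ln(2t + φ(t))| ≤ C/t² for all t > T). -/
open Set Filter Topology MeasureTheory

/-- The solution of `y' = r y + g` that is bounded at `+∞`, for `0 < re r` and bounded `g`. -/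
noncomputable def boundedResolvent (r : ℂ) (g : ℝ → ℂ) (t : ℝ) : ℂ :=
  -(Complex.exp (r * t) * ∫ s in Ioi t, Complex.exp (-r * s) * g s)

section boundedResolvent

variable {r : ℂ} {g h : ℝ → ℂ} {C : ℝ}

lemma integrableOn_exp_mul_of_bounded (hr : 0 < r.re) (hg : Continuous g)
    (hC : ∀ s, ‖g s‖ ≤ C) (t : ℝ) :
    IntegrableOn (fun s : ℝ ↦ Complex.exp (-r * s) * g s) (Ioi t) := by
  have h1 : IntegrableOn (fun s : ℝ ↦ Complex.exp (-r * s)) (Ioi t) :=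
    integrableOn_exp_mul_complex_Ioi (by simpa using hr) t
  exact h1.mul_bdd (c := C) hg.aestronglyMeasurable (Eventually.of_forall hC)

lemma hasDerivAt_boundedResolvent (hr : 0 < r.re) (hg : Continuous g)
    (hC : ∀ s, ‖g s‖ ≤ C) (t : ℝ) :
    HasDerivAt (boundedResolvent r g) (r * boundedResolvent r g t + g t) t := by
  set k : ℝ → ℂ := fun s ↦ Complex.exp (-r * s) * g s with hk
  have hkc : Continuous k := by fun_prop
  have hki := integrableOn_exp_mul_of_bounded hr hg hC
  have hint : HasDerivAt (fun u ↦ ∫ s in Ioi u, k s) (-k t) t := by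
    have h1 : (fun u ↦ ∫ s in Ioi u, k s) = fun u ↦ (∫ s in Ioi t, k s) - ∫ s in t..u, k s := by
      funext u
      rw [← intervalIntegral.integral_interval_add_Ioi' (hkc.intervalIntegrable t u) (hki u)]
      ring
    rw [h1]
    simpa using (intervalIntegral.integral_hasDerivAt_right (hkc.intervalIntegrable t t)
      (hkc.stronglyMeasurableAtFilter _ _) hkc.continuousAt).const_sub (∫ s in Ioi t, k s)
  have hexp : HasDerivAt (fun u : ℝ ↦ Complex.exp (r * u)) (Complex.exp (r * t) * (r * 1)) t :=
    ((hasDerivAt_id t).ofReal_comp.const_mul r).cexp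
  have : Complex.exp (r * t) * Complex.exp (-r * t) = 1 := by
    rw [← Complex.exp_add]; simp
  refine (hexp.mul hint).neg.congr_deriv ?_
  simp only [boundedResolvent, hk]
  linear_combination (g t) * this

lemma norm_boundedResolvent_le (hr : 0 < r.re) {t Q : ℝ} (hQ : ∀ s, t ≤ s → ‖g s‖ ≤ Q) :
    ‖boundedResolvent r g t‖ ≤ Q / r.re := by
  have hint : IntegrableOn (fun s : ℝ ↦ Real.exp (-r.re * s)) (Ioi t) :=
    integrableOn_exp_mul_Ioi (by linarith) t
  have h1 : ‖∫ s in Ioi t, Complex.exp (-r * s) * g s‖ ≤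
      ∫ s in Ioi t, Real.exp (-r.re * s) * Q := by
    refine norm_integral_le_of_norm_le (hint.mul_const Q) ?_
    refine (ae_restrict_iff' measurableSet_Ioi).2 (Eventually.of_forall fun s hs ↦ ?_)
    rw [norm_mul, Complex.norm_exp]
    have : (-r * (s : ℂ)).re = -r.re * s := by simp
    rw [this]
    exact mul_le_mul_of_nonneg_left (hQ s (le_of_lt hs)) (Real.exp_pos _).le
  rw [integral_mul_const, integral_exp_mul_Ioi (by linarith) t] at h1
  rw [boundedResolvent, norm_neg, norm_mul, Complex.norm_exp]
  have h2 : (r * (t : ℂ)).re = r.re * t := by simp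
  rw [h2]
  calc _ ≤ Real.exp (r.re * t) * (-Real.exp (-r.re * t) / -r.re * Q) := by gcongr
    _ = (Real.exp (r.re * t) * Real.exp (-r.re * t)) * (Q / r.re) := by field_simp
    _ = Q / r.re := by rw [← Real.exp_add]; simp

lemma boundedResolvent_sub (hr : 0 < r.re) (hg : Continuous g) (hh : Continuous h)
    (hgC : ∀ s, ‖g s‖ ≤ C) (hhC : ∀ s, ‖h s‖ ≤ C) (t : ℝ) :
    boundedResolvent r (fun s ↦ g s - h s) t = boundedResolvent r g t - boundedResolvent r h t := by
  simp only [boundedResolvent, mul_sub]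
  rw [integral_sub (integrableOn_exp_mul_of_bounded hr hg hgC t)
    (integrableOn_exp_mul_of_bounded hr hh hhC t)]
  ring

end boundedResolvent

/-- The roots of `X² - a X + b` with `0 < a`, `0 < b` have positive real part. -/
lemma exists_roots_re_pos {a b : ℝ} (ha : 0 < a) (hb : 0 < b) :
    ∃ r₁ r₂ : ℂ, 0 < r₁.re ∧ 0 < r₂.re ∧ r₁ + r₂ = a ∧ r₁ * r₂ = b := by
  rcases le_total 0 (a ^ 2 - 4 * b) with h | h
  · have hs := Real.sq_sqrt h
    have h0 := Real.sqrt_nonneg (a ^ 2 - 4 * b)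
    set d := √(a ^ 2 - 4 * b)
    have hd : d < a := by nlinarith
    refine ⟨((a + d) / 2 : ℝ), ((a - d) / 2 : ℝ), ?_, ?_, ?_, ?_⟩
    · rw [Complex.ofReal_re]; linarith
    · rw [Complex.ofReal_re]; linarith
    · push_cast; ring
    · rw [← Complex.ofReal_mul]; congr 1; linarith
  · have hs := Real.sq_sqrt (neg_nonneg.2 h)
    set d := √(-(a ^ 2 - 4 * b))
    refine ⟨⟨a / 2, d / 2⟩, ⟨a / 2, -(d / 2)⟩, by simpa, by simpa, ?_, ?_⟩
    · apply Complex.ext <;> simp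
    · apply Complex.ext
      · simp; linarith
      · simp; ring

open scoped BoundedContinuousFunction in
/-- If `G` is small and Lipschitz with a small constant, then `η'' - a η' + b η = G(t, η)` has a
solution dominated by the antitone function `p`. -/
lemma exists_solution_of_small {a b : ℝ} (ha : 0 < a) (hb : 0 < b) :
    ∃ ρ > (0 : ℝ), ∀ (G : ℝ → ℝ → ℝ) (p : ℝ → ℝ), Continuous (fun z : ℝ × ℝ ↦ G z.1 z.2) →
      Antitone p → BddAbove (range p) → (∀ s x, |G s x| ≤ ρ * p s) →
      (∀ s x y, |G s x - G s y| ≤ ρ / 2 * |x - y|) →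
      ∃ η v : ℝ → ℝ, ∀ t, HasDerivAt η (v t) t ∧
        HasDerivAt v (a * v t - b * η t + G t (η t)) t ∧ |η t| ≤ p t := by
  obtain ⟨r₁, r₂, h₁, h₂, hsum, hprod⟩ := exists_roots_re_pos ha hb
  refine ⟨r₁.re * r₂.re, by positivity, fun G p hG hp ⟨P, hP⟩ hGp hGl ↦ ?_⟩
  replace hP : ∀ s, p s ≤ P := fun s ↦ hP (mem_range_self s)
  set ρ := r₁.re * r₂.re with hρ
  have hρ0 : 0 < ρ := by positivity
  let g : (ℝ →ᵇ ℝ) → ℝ → ℂ := fun u s ↦ (G s (u s) : ℂ)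
  have hgc : ∀ u, Continuous (g u) := fun u ↦
    Complex.continuous_ofReal.comp (hG.comp (continuous_id.prodMk u.continuous))
  have hgp : ∀ u s, ‖g u s‖ ≤ ρ * p s := fun u s ↦ by
    simpa [g, Complex.norm_real] using hGp s (u s)
  have hgP : ∀ u s, ‖g u s‖ ≤ ρ * P := fun u s ↦
    (hgp u s).trans (by gcongr; exact hP s)
  let h : (ℝ →ᵇ ℝ) → ℝ → ℂ := fun u ↦ boundedResolvent r₁ (g u)
  have hhd : ∀ u t, HasDerivAt (h u) (r₁ * h u t + g u t) t := fun u ↦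
    hasDerivAt_boundedResolvent h₁ (hgc u) (hgP u)
  have hhc : ∀ u, Continuous (h u) := fun u ↦
    continuous_iff_continuousAt.2 fun t ↦ (hhd u t).continuousAt
  have hhp : ∀ u t, ‖h u t‖ ≤ r₂.re * p t := fun u t ↦ by
    refine (norm_boundedResolvent_le h₁ (Q := ρ * p t) fun s hs ↦
      (hgp u s).trans (by gcongr; exact hp hs)).trans (le_of_eq ?_)
    rw [hρ]; field_simp
  have hhP : ∀ u t, ‖h u t‖ ≤ r₂.re * P := fun u t ↦
    (hhp u t).trans (by gcongr; exact hP t)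
  let k : (ℝ →ᵇ ℝ) → ℝ → ℂ := fun u ↦ boundedResolvent r₂ (h u)
  have hkd : ∀ u t, HasDerivAt (k u) (r₂ * k u t + h u t) t := fun u ↦
    hasDerivAt_boundedResolvent h₂ (hhc u) (hhP u)
  have hkc : ∀ u, Continuous (k u) := fun u ↦
    continuous_iff_continuousAt.2 fun t ↦ (hkd u t).continuousAt
  have hkp : ∀ u t, ‖k u t‖ ≤ p t := fun u t ↦ by
    refine (norm_boundedResolvent_le h₂ (Q := r₂.re * p t) fun s hs ↦
      (hhp u s).trans (by gcongr; exact hp hs)).trans (le_of_eq ?_)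
    field_simp
  let Φ : (ℝ →ᵇ ℝ) → (ℝ →ᵇ ℝ) := fun u ↦
    BoundedContinuousFunction.ofNormedAddCommGroup (fun t ↦ (k u t).re)
      (Complex.continuous_re.comp (hkc u)) P
      (fun t ↦ (Complex.abs_re_le_norm _).trans ((hkp u t).trans (hP t)))
  have hlip : LipschitzWith (1 / 2) Φ := by
    refine LipschitzWith.of_dist_le_mul fun u v ↦ ?_
    refine (BoundedContinuousFunction.dist_le (by positivity)).2 fun t ↦ ?_
    have e1 : ∀ s, ‖g u s - g v s‖ ≤ ρ / 2 * dist u v := fun s ↦ by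
      have := hGl s (u s) (v s)
      rw [← Complex.ofReal_sub, Complex.norm_real]
      refine this.trans ?_
      gcongr
      exact BoundedContinuousFunction.dist_coe_le_dist (f := u) (g := v) s
    have e2 : ∀ s, ‖h u s - h v s‖ ≤ ρ / 2 * dist u v / r₁.re := fun s ↦ by
      rw [← boundedResolvent_sub h₁ (hgc u) (hgc v) (hgP u) (hgP v)]
      exact norm_boundedResolvent_le h₁ fun s _ ↦ e1 s
    have e3 : ‖k u t - k v t‖ ≤ ρ / 2 * dist u v / r₁.re / r₂.re := by
      rw [← boundedResolvent_sub h₂ (hhc u) (hhc v) (hhP u) (hhP v)]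
      exact norm_boundedResolvent_le h₂ fun s _ ↦ e2 s
    calc dist (Φ u t) (Φ v t) = |(k u t - k v t).re| := by
          rw [Real.dist_eq, Complex.sub_re]; rfl
      _ ≤ ‖k u t - k v t‖ := Complex.abs_re_le_norm _
      _ ≤ _ := e3
      _ = _ := by rw [hρ]; push_cast; field_simp
  have hcon : ContractingWith (1 / 2) Φ := ⟨by
    rw [← NNReal.coe_lt_coe]; push_cast; norm_num, hlip⟩
  set u := ContractingWith.fixedPoint Φ hcon
  have hu : Φ u = u := hcon.fixedPoint_isFixedPt
  have hut : ∀ t, u t = (k u t).re := fun t ↦ (DFunLike.congr_fun hu t).symm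
  refine ⟨fun t ↦ (k u t).re, fun t ↦ (r₂ * k u t + h u t).re, fun t ↦ ⟨?_, ?_, ?_⟩⟩
  · exact Complex.reCLM.hasFDerivAt.comp_hasDerivAt t (hkd u t)
  · have H := ((hkd u t).const_mul r₂).add (hhd u t)
    have e : r₂ * (r₂ * k u t + h u t) + (r₁ * h u t + g u t) =
        (a : ℂ) * (r₂ * k u t + h u t) - (b : ℂ) * k u t + g u t := by
      rw [← hsum, ← hprod]; ring
    rw [e] at H
    refine (Complex.reCLM.hasFDerivAt.comp_hasDerivAt t H).congr_deriv ?_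
    simp [g, ← hut]
  · exact (Complex.abs_re_le_norm _).trans (hkp u t)

lemma abs_max_min_le {lo hi x : ℝ} (h0 : 0 ≤ lo) (h : lo ≤ hi) : |max lo (min hi x)| ≤ hi := by
  rw [abs_of_nonneg (h0.trans (le_max_left _ _))]
  exact max_le h (min_le_left _ _)

lemma abs_max_min_sub_le (lo hi x y : ℝ) :
    |max lo (min hi x) - max lo (min hi y)| ≤ |x - y| := by
  refine (abs_max_sub_max_le_max lo (min hi x) lo (min hi y)).trans ?_
  refine max_le (by simp) ((abs_min_sub_min_le_max hi x hi y).trans (max_le (by simp) le_rfl))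

lemma abs_exp_exp_sub_le {M x y : ℝ} (hx : x ≤ M) (hy : y ≤ M) :
    |Real.exp (Real.exp x) - Real.exp (Real.exp y)| ≤
      Real.exp (Real.exp M) * Real.exp M * |x - y| := by
  have := (convex_Iic M).norm_image_sub_le_of_norm_hasDerivWithin_le
    (f := fun x ↦ Real.exp (Real.exp x)) (f' := fun x ↦ Real.exp (Real.exp x) * Real.exp x)
    (C := Real.exp (Real.exp M) * Real.exp M) (fun z _ ↦
      ((Real.hasDerivAt_exp z).exp).hasDerivWithinAt) (fun z (hz : z ≤ M) ↦ by
      rw [Real.norm_of_nonneg (by positivity)]; gcongr) hy hx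
  simpa [Real.norm_eq_abs] using this

/-- The equation with truncated unknowns, written for `w` and `y = e^{-at} w'`, has solutions on
every compact interval. -/
lemma exists_truncated_solution {a A B M y₀ Y : ℝ} (ha : 0 < a) (hAB : A ≤ B) (hM : 0 ≤ M)
    (hy₀ : 0 ≤ y₀) (hY : y₀ ≤ Y) :
    ∃ w y : ℝ → ℝ, w B = M ∧ y B = y₀ ∧ ∀ t ∈ Icc A B,
      HasDerivWithinAt w (Real.exp (a * t) * max y₀ (min Y (y t))) (Icc A B) t ∧
      HasDerivWithinAt y
        (-(Real.exp (-(a + 2) * t) * Real.exp (Real.exp (max 0 (min M (w t)))))) (Icc A B) t := by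
  set K₁ := Real.exp (a * B) with hK₁
  set K₂ := Real.exp (-(a + 2) * A) with hK₂
  set E := Real.exp (Real.exp M) with hE
  have hY0 := hy₀.trans hY
  let f : ℝ → ℝ × ℝ → ℝ × ℝ := fun t z ↦ (Real.exp (a * t) * max y₀ (min Y z.2),
    -(Real.exp (-(a + 2) * t) * Real.exp (Real.exp (max 0 (min M z.1)))))
  let K : NNReal := ⟨K₁ + K₂ * (E * Real.exp M), by positivity⟩
  let L : NNReal := ⟨K₁ * Y + K₂ * E, by positivity⟩
  have b₁ : ∀ t ∈ Icc A B, Real.exp (a * t) ≤ K₁ := fun t ht ↦ by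
    rw [hK₁]; gcongr; exact ht.2
  have b₂ : ∀ t ∈ Icc A B, Real.exp (-(a + 2) * t) ≤ K₂ := fun t ht ↦
    Real.exp_le_exp.2 (by nlinarith [ht.1])
  have hpl : IsPicardLindelof f (⟨B, hAB, le_rfl⟩ : Icc A B) (M, y₀) (L * ⟨B - A, by linarith⟩)
      0 L K := by
    refine ⟨fun t ht ↦ ?_, fun z _ ↦ ?_, fun t ht z _ ↦ ?_, ?_⟩
    · refine (LipschitzWith.of_dist_le_mul fun z z' ↦ ?_).lipschitzOnWith
      have d₁ : |z.1 - z'.1| ≤ dist z z' := by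
        rw [← Real.dist_eq, Prod.dist_eq]; exact le_max_left _ _
      have d₂ : |z.2 - z'.2| ≤ dist z z' := by
        rw [← Real.dist_eq, Prod.dist_eq]; exact le_max_right _ _
      have hK : (K : ℝ) = K₁ + K₂ * (E * Real.exp M) := rfl
      rw [Prod.dist_eq (x := f t z), hK]
      refine max_le ?_ ?_
      · rw [Real.dist_eq, ← mul_sub, abs_mul, Real.abs_exp]
        calc _ ≤ K₁ * dist z z' :=
              mul_le_mul (b₁ t ht) ((abs_max_min_sub_le _ _ _ _).trans d₂) (abs_nonneg _)
                (Real.exp_pos _).le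
          _ ≤ _ := by gcongr; exact le_add_of_nonneg_right (by positivity)
      · rw [dist_neg_neg, Real.dist_eq, ← mul_sub, abs_mul, Real.abs_exp]
        calc _ ≤ K₂ * (E * Real.exp M * dist z z') := by
              refine mul_le_mul (b₂ t ht) ?_ (abs_nonneg _) (Real.exp_pos _).le
              refine (abs_exp_exp_sub_le (M := M) (max_le hM (min_le_left _ _))
                (max_le hM (min_le_left _ _))).trans ?_
              gcongr
              exact (abs_max_min_sub_le _ _ _ _).trans d₁
          _ = K₂ * (E * Real.exp M) * dist z z' := by ring
          _ ≤ _ := by gcongr; exact le_add_of_nonneg_left (by positivity)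
    · exact Continuous.continuousOn (by fun_prop)
    · have hL : (L : ℝ) = K₁ * Y + K₂ * E := rfl
      rw [Prod.norm_def, hL]
      refine max_le ?_ ?_
      · rw [Real.norm_eq_abs, abs_mul, Real.abs_exp]
        have := mul_le_mul (b₁ t ht) (abs_max_min_le (x := z.2) hy₀ hY) (abs_nonneg _)
          (Real.exp_pos _).le
        have : 0 ≤ K₂ * E := by positivity
        linarith
      · rw [Real.norm_eq_abs, abs_neg, abs_mul, Real.abs_exp, Real.abs_exp]
        have : Real.exp (Real.exp (max 0 (min M z.1))) ≤ E := by
          rw [hE]; gcongr; exact max_le hM (min_le_left _ _)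
        have := mul_le_mul (b₂ t ht) this (Real.exp_pos _).le (Real.exp_pos _).le
        have : 0 ≤ K₁ * Y := by positivity
        linarith
    · have : max (B - B) (B - A) = B - A := max_eq_right (by linarith)
      simp only [this, NNReal.coe_zero, sub_zero]
      exact le_rfl
  obtain ⟨α, hα, hα'⟩ := hpl.exists_eq_forall_mem_Icc_hasDerivWithinAt₀
  refine ⟨fun t ↦ (α t).1, fun t ↦ (α t).2, congrArg Prod.fst hα, congrArg Prod.snd hα,
    fun t ht ↦ ⟨?_, ?_⟩⟩
  · exact (hasFDerivAt_fst (𝕜 := ℝ)).comp_hasDerivWithinAt t (hα' t ht)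
  · exact (hasFDerivAt_snd (𝕜 := ℝ)).comp_hasDerivWithinAt t (hα' t ht)

/-- Going backwards from a point where `w` and `w'` are positive, `w` reaches zero. -/
lemma exists_backward_solution {a B M v₀ : ℝ} (ha : 0 < a) (hM : 0 < M) (hv₀ : 0 < v₀) :
    ∃ A < B, ∃ w v : ℝ → ℝ, w A = 0 ∧ w B = M ∧ v B = v₀ ∧ (∀ t ∈ Ioc A B, 0 < w t) ∧
      ∀ t ∈ Icc A B, HasDerivWithinAt w (v t) (Icc A B) t ∧
        HasDerivWithinAt v (a * v t - Real.exp (-2 * t + Real.exp (w t))) (Icc A B) t := by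
  set A := min (B - 2) (-(a + 4 + Real.log M) / 2) with hA
  have hAB : A ≤ B - 2 := min_le_left _ _
  have hAM : Real.log M ≤ -2 * A - a - 4 := by
    have : A ≤ -(a + 4 + Real.log M) / 2 := min_le_right _ _
    linarith
  set y₀ := Real.exp (-(a * B)) * v₀ with hy₀
  have hy₀' : 0 < y₀ := by positivity
  set K := Real.exp (-(a + 2) * A) * Real.exp (Real.exp M) with hK
  set Y := y₀ + K * (B - A) with hY
  have hK0 : 0 ≤ K := by positivity
  have hyY : y₀ ≤ Y := by rw [hY]; nlinarith
  obtain ⟨w, y, hwB, hyB, hwy⟩ := exists_truncated_solution (A := A) (B := B) (M := M) ha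
    (by linarith) hM.le hy₀'.le hyY
  set dw : ℝ → ℝ := fun t ↦ Real.exp (a * t) * max y₀ (min Y (y t)) with hdw
  set dy : ℝ → ℝ := fun t ↦
    -(Real.exp (-(a + 2) * t) * Real.exp (Real.exp (max 0 (min M (w t))))) with hdy
  have hwc : ContinuousOn w (Icc A B) := fun t ht ↦ (hwy t ht).1.continuousWithinAt
  have hyc : ContinuousOn y (Icc A B) := fun t ht ↦ (hwy t ht).2.continuousWithinAt
  have hwd : ∀ t ∈ Ioo A B, HasDerivAt w (dw t) t := fun t ht ↦
    (hwy t (Ioo_subset_Icc_self ht)).1.hasDerivAt (Icc_mem_nhds ht.1 ht.2)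
  have hyd : ∀ t ∈ Ioo A B, HasDerivAt y (dy t) t := fun t ht ↦
    (hwy t (Ioo_subset_Icc_self ht)).2.hasDerivAt (Icc_mem_nhds ht.1 ht.2)
  have hdw0 : ∀ t, 0 < dw t := fun t ↦
    mul_pos (Real.exp_pos _) (hy₀'.trans_le (le_max_left _ _))
  have hwmono : StrictMonoOn w (Icc A B) :=
    strictMonoOn_of_deriv_pos (convex_Icc A B) hwc fun t ht ↦ by
      rw [interior_Icc] at ht
      rw [(hwd t ht).deriv]; exact hdw0 t
  -- Mean value theorem for `y` and `w` on subintervals.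
  have mvy : ∀ s ∈ Icc A B, ∀ t ∈ Icc A B, s < t → ∃ c ∈ Ioo s t, y t - y s = dy c * (t - s) := by
    intro s hs t ht hst
    obtain ⟨c, hc, h⟩ := exists_hasDerivAt_eq_slope y dy hst
      (hyc.mono (Icc_subset_Icc hs.1 ht.2))
      (fun x hx ↦ hyd x ⟨hs.1.trans_lt hx.1, hx.2.trans_le ht.2⟩)
    exact ⟨c, hc, by rw [h, div_mul_cancel₀]; linarith⟩
  have hyB' : ∀ t ∈ Icc A B, y₀ ≤ y t ∧ y t ≤ Y := by
    intro t ht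
    rcases ht.2.eq_or_lt with rfl | htB
    · rw [hyB]; exact ⟨le_rfl, hyY⟩
    obtain ⟨c, hc, h⟩ := mvy t ht B ⟨by linarith, le_rfl⟩ htB
    have h1 : 0 ≤ -dy c := by simp only [hdy, neg_neg]; positivity
    have h2 : -dy c ≤ K := by
      simp only [hdy, neg_neg, hK]
      have := ht.1.trans hc.1.le
      refine mul_le_mul (Real.exp_le_exp.2 (by nlinarith)) ?_ (Real.exp_pos _).le
        (Real.exp_pos _).le
      gcongr
      exact max_le hM.le (min_le_left _ _)
    rw [hyB] at h
    refine ⟨by nlinarith, ?_⟩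
    rw [hY]
    have : -dy c * (B - t) ≤ K * (B - A) :=
      mul_le_mul h2 (by linarith [ht.1]) (by linarith) hK0
    linarith
  have hdw' : ∀ t ∈ Icc A B, dw t = Real.exp (a * t) * y t := fun t ht ↦ by
    obtain ⟨h1, h2⟩ := hyB' t ht
    simp only [hdw]
    rw [min_eq_right h2, max_eq_right h1]
  have hwA : w A ≤ 0 := by
    obtain ⟨c, hc, h⟩ := exists_hasDerivAt_eq_slope w dw (show A < A + 1 by linarith)
      (hwc.mono (Icc_subset_Icc le_rfl (by linarith)))
      (fun x hx ↦ hwd x ⟨hx.1, by linarith [hx.2]⟩)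
    have hcI : c ∈ Icc A B := ⟨hc.1.le, by linarith [hc.2]⟩
    have hcI' : c + 1 ∈ Icc A B := ⟨by linarith [hc.1], by linarith [hc.2]⟩
    obtain ⟨d, hd, h'⟩ := mvy c hcI (c + 1) hcI' (by linarith)
    have e1 : Real.exp (-(a + 2) * (c + 1)) ≤ -dy d := by
      simp only [hdy, neg_neg]
      have h1 : Real.exp (-(a + 2) * (c + 1)) ≤ Real.exp (-(a + 2) * d) :=
        Real.exp_le_exp.2 (by nlinarith [hd.2])
      have h2 : 1 ≤ Real.exp (Real.exp (max 0 (min M (w d)))) :=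
        Real.one_le_exp (Real.exp_pos _).le
      nlinarith [Real.exp_pos (-(a + 2) * d)]
    have e2 : Real.exp (-(a + 2) * (c + 1)) ≤ y c := by
      have := (hyB' _ hcI').1
      linarith
    have e3 : M ≤ dw c := by
      rw [hdw' c hcI]
      calc M = Real.exp (Real.log M) := (Real.exp_log hM).symm
        _ ≤ Real.exp (a * c + -(a + 2) * (c + 1)) :=
          Real.exp_le_exp.2 (by linarith [hc.2])
        _ = Real.exp (a * c) * Real.exp (-(a + 2) * (c + 1)) := Real.exp_add _ _
        _ ≤ _ := by gcongr
    have e4 : w (A + 1) ≤ M := by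
      rw [← hwB]
      exact hwmono.monotoneOn ⟨by linarith, by linarith⟩ ⟨by linarith, le_rfl⟩ (by linarith)
    rw [h, add_sub_cancel_left, div_one] at e3
    linarith
  obtain ⟨T, hT, hwT⟩ := intermediate_value_Icc (by linarith : A ≤ B) hwc
    (show (0 : ℝ) ∈ Icc (w A) (w B) from ⟨hwA, by rw [hwB]; exact hM.le⟩)
  have hTB : T < B := lt_of_le_of_ne hT.2 fun h ↦ by rw [h, hwB] at hwT; linarith
  have hsub : Icc T B ⊆ Icc A B := Icc_subset_Icc hT.1 le_rfl
  refine ⟨T, hTB, w, fun t ↦ Real.exp (a * t) * y t, hwT, hwB, ?_, fun t ht ↦ ?_,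
    fun t ht ↦ ⟨?_, ?_⟩⟩
  · beta_reduce
    rw [hyB, hy₀, ← mul_assoc, ← Real.exp_add]; simp
  · rw [← hwT]
    exact hwmono hT (hsub (Ioc_subset_Icc_self ht)) ht.1
  · exact ((hwy t (hsub ht)).1.mono hsub).congr_deriv (hdw' t (hsub ht))
  · have h0 : 0 ≤ w t := by
      rw [← hwT]; exact hwmono.monotoneOn hT (hsub ht) ht.1
    have h1 : w t ≤ M := by
      rw [← hwB]; exact hwmono.monotoneOn (hsub ht) ⟨by linarith, le_rfl⟩ ht.2
    have e1 : HasDerivWithinAt (fun t ↦ Real.exp (a * t)) (Real.exp (a * t) * (a * 1))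
        (Icc T B) t := ((hasDerivAt_id t).const_mul a).exp.hasDerivWithinAt
    refine (e1.mul ((hwy t (hsub ht)).2.mono hsub)).congr_deriv ?_
    rw [min_eq_right h1, max_eq_right h0, Real.exp_add]
    have : Real.exp (-2 * t) = Real.exp (a * t) * Real.exp (-(a + 2) * t) := by
      rw [← Real.exp_add]; congr 1; ring
    rw [this]; ring

/-- Gluing two differentiable functions at a point where values and derivatives agree. -/
lemma hasDerivAt_ite_le {f g f' g' : ℝ → ℝ} {A B : ℝ} (hfg : f B = g B) (hfg' : f' B = g' B)
    (hf : ∀ t ∈ Icc A B, HasDerivWithinAt f (f' t) (Icc A B) t)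
    (hg : ∀ t ≥ B, HasDerivAt g (g' t) t) {t : ℝ} (ht : A < t) :
    HasDerivAt (fun t ↦ if t ≤ B then f t else g t) (if t ≤ B then f' t else g' t) t := by
  rcases lt_trichotomy t B with h | rfl | h
  · rw [if_pos h.le]
    refine ((hf t ⟨ht.le, h.le⟩).hasDerivAt (Icc_mem_nhds ht h)).congr_of_eventuallyEq ?_
    filter_upwards [Iio_mem_nhds h] with s hs
    exact if_pos (le_of_lt hs)
  · rw [if_pos le_rfl]
    have h1 : HasDerivWithinAt (fun s ↦ if s ≤ t then f s else g s) (f' t) (Icc A t) t :=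
      (hf t ⟨ht.le, le_rfl⟩).congr (fun s hs ↦ if_pos hs.2) (if_pos le_rfl)
    have h2 : HasDerivWithinAt (fun s ↦ if s ≤ t then f s else g s) (f' t) (Ici t) t := by
      rw [hfg']
      refine (hg t le_rfl).hasDerivWithinAt.congr (fun s hs ↦ ?_) ?_
      · by_cases hst : s ≤ t
        · obtain rfl : s = t := le_antisymm hst hs
          rw [if_pos le_rfl, hfg]
        · exact if_neg hst
      · rw [if_pos le_rfl, hfg]
    refine (h1.union h2).hasDerivAt ?_
    filter_upwards [Ioi_mem_nhds ht] with s hs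
    exact (le_total s t).imp (fun h ↦ ⟨le_of_lt hs, h⟩) id
  · rw [if_neg h.not_ge]
    refine (hg t h.le).congr_of_eventuallyEq ?_
    filter_upwards [Ioi_mem_nhds h] with s hs
    exact if_neg (not_le.2 hs)

/-- The approximate profile `2t + φ(t)`, whose logarithm approximates the singular solution. -/
noncomputable def expProfile (a t : ℝ) : ℝ :=
  2 * t + (Real.log (a / t) + Real.log (1 + Real.log t / (2 * t)))

/-- The derivative of `expProfile a`. -/
noncomputable def expProfileDeriv (t : ℝ) : ℝ :=
  2 - 1 / t + (1 - Real.log t) / (t * (2 * t + Real.log t))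

/-- The second derivative of `expProfile a`. -/
noncomputable def expProfileDeriv₂ (t : ℝ) : ℝ :=
  1 / t ^ 2 + (-(2 * t + Real.log t) - (1 - Real.log t) * (4 * t + Real.log t + 1)) /
    (t * (2 * t + Real.log t)) ^ 2

section expProfile

variable {a t : ℝ}

lemma expProfile_eq (ha : 0 < a) (ht : 0 < t) :
    expProfile a t =
      2 * t + (Real.log a - Real.log t + Real.log (1 + Real.log t / t / 2)) := by
  rw [expProfile, Real.log_div ha.ne' ht.ne', div_div, mul_comm t 2]

lemma exp_expProfile (ha : 0 < a) (ht : 1 < t) :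
    Real.exp (-2 * t + expProfile a t) = a / t * (1 + Real.log t / (2 * t)) := by
  have hL := Real.log_pos ht
  have h : -2 * t + expProfile a t =
    Real.log (a / t) + Real.log (1 + Real.log t / (2 * t)) := by rw [expProfile]; ring
  rw [h, Real.exp_add, Real.exp_log (by positivity), Real.exp_log (by positivity)]

lemma hasDerivAt_expProfile (ha : 0 < a) (ht : 1 < t) :
    HasDerivAt (expProfile a) (expProfileDeriv t) t := by
  have ht0 : 0 < t := by linarith
  have hL := Real.log_pos ht
  have hlog := Real.hasDerivAt_log ht0.ne'
  have h1 : HasDerivAt (fun s : ℝ ↦ a / s) (-a / t ^ 2) t := by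
    simpa [div_eq_mul_inv] using (hasDerivAt_inv ht0.ne').const_mul a
  have h2 : HasDerivAt (fun s : ℝ ↦ 2 * s) 2 t := by
    simpa using (hasDerivAt_id t).const_mul (2 : ℝ)
  have h3 := (hlog.div h2 (by positivity)).const_add 1
  have h4 : (1 + Real.log t / (2 * t)) ≠ 0 := by positivity
  refine (h2.add ((h1.log (by positivity)).add (h3.log h4))).congr_deriv ?_
  rw [expProfileDeriv]
  have : 2 * t + Real.log t ≠ 0 := by positivity
  simp only [Pi.div_apply]
  field_simp
  ring

lemma hasDerivAt_expProfileDeriv (ht : 1 < t) :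
    HasDerivAt expProfileDeriv (expProfileDeriv₂ t) t := by
  have ht0 : 0 < t := by linarith
  have hL := Real.log_pos ht
  have hlog := Real.hasDerivAt_log ht0.ne'
  have h0 := hasDerivAt_id t
  have hden : t * (2 * t + Real.log t) ≠ 0 := by positivity
  have h1 : HasDerivAt (fun s : ℝ ↦ 1 / s) (-1 / t ^ 2) t := by
    simpa [neg_div] using hasDerivAt_inv ht0.ne'
  refine ((h1.const_sub 2).add ((hlog.const_sub 1).div (h0.mul ((h0.const_mul 2).add hlog))
    hden)).congr_deriv ?_
  rw [expProfileDeriv₂]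
  have : 2 * t + Real.log t ≠ 0 := by positivity
  simp only [Pi.mul_apply, Pi.add_apply, id]
  field_simp
  ring

lemma tendsto_log_div : Tendsto (fun t : ℝ ↦ Real.log t / t) atTop (𝓝 0) := by
  simpa using Real.tendsto_pow_log_div_mul_add_atTop 1 0 1 one_ne_zero

lemma tendsto_log_sq_div : Tendsto (fun t : ℝ ↦ Real.log t ^ 2 / t) atTop (𝓝 0) := by
  simpa using Real.tendsto_pow_log_div_mul_add_atTop 1 0 2 one_ne_zero

lemma tendsto_one_div_id : Tendsto (fun t : ℝ ↦ 1 / t) atTop (𝓝 0) := by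
  simpa using tendsto_inv_atTop_zero (𝕜 := ℝ)

lemma tendsto_log_one_add_log_div :
    Tendsto (fun t : ℝ ↦ Real.log (1 + Real.log t / t / 2)) atTop (𝓝 0) := by
  have h : Tendsto (fun t : ℝ ↦ 1 + Real.log t / t / 2) atTop (𝓝 1) := by
    simpa using (tendsto_log_div.div_const 2).const_add 1
  simpa using h.log one_ne_zero

lemma tendsto_expProfile_div (ha : 0 < a) :
    Tendsto (fun t ↦ expProfile a t / t) atTop (𝓝 2) := by
  have h : Tendsto (fun t : ℝ ↦ 2 + (Real.log a * (1 / t) - Real.log t / t +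
      Real.log (1 + Real.log t / t / 2) * (1 / t))) atTop
      (𝓝 (2 + (Real.log a * 0 - 0 + 0 * 0))) :=
    (((tendsto_one_div_id.const_mul _).sub tendsto_log_div).add
      (tendsto_log_one_add_log_div.mul tendsto_one_div_id)).const_add 2
  simp only [mul_zero, sub_zero, add_zero] at h
  refine h.congr' ?_
  filter_upwards [eventually_gt_atTop 0] with t ht
  rw [expProfile_eq ha ht]
  field_simp

lemma tendsto_expProfile (ha : 0 < a) : Tendsto (expProfile a) atTop atTop := by
  refine ((tendsto_expProfile_div ha).pos_mul_atTop two_pos tendsto_id).congr' ?_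
  filter_upwards [eventually_gt_atTop 0] with t ht
  simp only [id]
  field_simp

/-- The residual of `log (2t + φ(t))` in the equation is `O(1/t²)`. -/
lemma exists_residual_le (ha : 0 < a) :
    ∃ R > (0 : ℝ), ∀ᶠ t in atTop,
      |(expProfileDeriv₂ t / expProfile a t - (expProfileDeriv t / expProfile a t) ^ 2)
        - a * (expProfileDeriv t / expProfile a t) + Real.exp (-2 * t + expProfile a t)|
        ≤ R / t ^ 2 := by
  set l : ℝ → ℝ := fun t ↦ Real.log t / t with hl
  set m : ℝ → ℝ := fun t ↦ Real.log t ^ 2 / t with hm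
  set i : ℝ → ℝ := fun t ↦ 1 / t with hi
  set P : ℝ → ℝ := fun t ↦ Real.log (1 + Real.log t / t / 2) with hP
  set V : ℝ → ℝ := fun t ↦ expProfile a t / t with hV
  have tl : Tendsto l atTop (𝓝 0) := tendsto_log_div
  have tm : Tendsto m atTop (𝓝 0) := tendsto_log_sq_div
  have ti : Tendsto i atTop (𝓝 0) := tendsto_one_div_id
  have tP : Tendsto P atTop (𝓝 0) := tendsto_log_one_add_log_div
  have tV : Tendsto V atTop (𝓝 2) := tendsto_expProfile_div ha
  -- `q = t * (W' - 2 + 1/t)`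
  set q : ℝ → ℝ := fun t ↦ (i t - l t) / (2 + l t) with hq
  have tq : Tendsto q atTop (𝓝 ((0 - 0) / (2 + 0))) :=
    (ti.sub tl).div (tl.const_add 2) (by norm_num)
  obtain ⟨c, tX⟩ : ∃ c, Tendsto (fun t ↦
      (i t + i t * (-(2 * i t + l t * i t) - (i t - l t) * (4 + l t + i t)) / (2 + l t) ^ 2) / V t
      - ((2 - i t + i t * q t) / V t) ^ 2
      + a * ((Real.log a + P t + 1 - q t) / V t
        + (l t * Real.log a - m t + l t * P t) / (2 * V t))) atTop (𝓝 c) := by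
    have h₁ := (ti.add ((ti.mul ((((ti.const_mul 2).add (tl.mul ti)).neg).sub
      ((ti.sub tl).mul ((tl.const_add 4).add ti)))).div ((tl.const_add 2).pow 2)
        (by norm_num))).div tV two_ne_zero
    have h₂ := (((ti.const_sub 2).add (ti.mul tq)).div tV two_ne_zero).pow 2
    have h₃ := (((tP.const_add (Real.log a)).add_const 1).sub tq).div tV two_ne_zero
    have h₄ := (((tl.mul_const (Real.log a)).sub tm).add (tl.mul tP)).div (tV.const_mul 2)
      (by norm_num)
    exact ⟨_, (h₁.sub h₂).add ((h₃.add h₄).const_mul a)⟩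
  have hX := tX.abs.eventually (gt_mem_nhds (lt_add_one _))
  refine ⟨|c| + 1, by positivity, ?_⟩
  filter_upwards [hX, eventually_gt_atTop 1, (tendsto_expProfile ha).eventually_gt_atTop 0]
    with t hXt ht hW
  have ht0 : 0 < t := by linarith
  have hL := Real.log_pos ht
  rw [le_div_iff₀ (by positivity), ← abs_of_pos (show 0 < t ^ 2 by positivity), ← abs_mul]
  refine le_trans (le_of_eq ?_) hXt.le
  congr 1
  have hPt : P t = expProfile a t - 2 * t - Real.log a + Real.log t := by
    rw [expProfile_eq ha ht0]; ring
  rw [exp_expProfile ha ht, hPt]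
  simp only [hl, hm, hi, hV, hq, expProfileDeriv, expProfileDeriv₂]
  have h2 : 2 * t + Real.log t ≠ 0 := by positivity
  have h3 : 2 + Real.log t / t = (2 * t + Real.log t) / t := by field_simp
  rw [h3]
  generalize expProfile a t = W at *
  generalize Real.log t = L at *
  generalize Real.log a = A at *
  field_simp
  ring

/-- The derivative of the nonlinearity near the approximate profile tends to `2a`. -/
lemma tendsto_nonlinearity_deriv (ha : 0 < a) (c : ℝ) :
    Tendsto (fun t ↦ Real.exp (-2 * t + expProfile a t * Real.exp (c / t ^ 2)) *
      (expProfile a t * Real.exp (c / t ^ 2))) atTop (𝓝 (2 * a)) := by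
  have tV := tendsto_expProfile_div ha
  have tx : Tendsto (fun t : ℝ ↦ c / t ^ 2) atTop (𝓝 0) := by
    simpa [div_eq_mul_inv] using (tendsto_one_div_id.pow 2).const_mul c
  have te : Tendsto (fun t : ℝ ↦ Real.exp (c / t ^ 2)) atTop (𝓝 1) := by
    simpa using tx.rexp
  have td : Tendsto (fun t : ℝ ↦ t * (Real.exp (c / t ^ 2) - 1)) atTop (𝓝 0) := by
    have h0 : Tendsto (fun t : ℝ ↦ 2 * |c| * (1 / t)) atTop (𝓝 0) := by
      simpa using tendsto_one_div_id.const_mul (2 * |c|)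
    refine squeeze_zero_norm' ?_ h0
    filter_upwards [eventually_gt_atTop 0, tx.abs.eventually
      (gt_mem_nhds (by simp : |(0 : ℝ)| < 1))]
      with t ht hxt
    rw [Real.norm_eq_abs, abs_mul, abs_of_pos ht]
    calc _ ≤ t * (2 * |c / t ^ 2|) := by gcongr; exact Real.abs_exp_sub_one_le hxt.le
      _ = _ := by rw [abs_div, abs_of_pos (show 0 < t ^ 2 by positivity)]; field_simp
  have h := ((((tendsto_log_div.div_const 2).const_add 1).const_mul a).mul
    (tV.mul td).rexp).mul (tV.mul te)
  have e : a * (1 + 0 / 2) * Real.exp (2 * 0) * (2 * 1) = 2 * a := by simp; ring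
  rw [e] at h
  refine h.congr' ?_
  filter_upwards [eventually_gt_atTop 1] with t ht
  have ht0 : 0 < t := by linarith
  have e1 : -2 * t + expProfile a t * Real.exp (c / t ^ 2) = (-2 * t + expProfile a t) +
      expProfile a t / t * (t * (Real.exp (c / t ^ 2) - 1)) := by field_simp; ring
  rw [e1, Real.exp_add, exp_expProfile ha ht]
  field_simp

end expProfile

/-- A solution on a neighbourhood of `+∞` with the prescribed asymptotics. -/
lemma exists_solution_near_infinity {a : ℝ} (ha : 0 < a) :
    ∃ T > (0 : ℝ), ∃ C > (0 : ℝ), ∃ w v : ℝ → ℝ, ∀ t ≥ T, HasDerivAt w (v t) t ∧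
      HasDerivAt v (a * v t - Real.exp (-2 * t + Real.exp (w t))) t ∧
      |w t - Real.log (expProfile a t)| ≤ C / t ^ 2 := by
  obtain ⟨ρ, hρ, hsol⟩ := exists_solution_of_small ha (show 0 < 2 * a by linarith)
  obtain ⟨R, hR, hres⟩ := exists_residual_le ha
  set C := 2 * R / ρ with hC
  have hC0 : 0 < C := by positivity
  have hCρ : ρ * C = 2 * R := by rw [hC]; field_simp
  have hnear : ∀ c : ℝ, ∀ᶠ t in atTop,
      |Real.exp (-2 * t + expProfile a t * Real.exp (c / t ^ 2)) *
        (expProfile a t * Real.exp (c / t ^ 2)) - 2 * a| < ρ / 2 := fun c ↦ by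
    simpa [Real.dist_eq] using
      (tendsto_nonlinearity_deriv ha c).eventually (Metric.ball_mem_nhds _ (half_pos hρ))
  obtain ⟨T, hT⟩ := eventually_atTop.1 ((hres.and ((hnear C).and (hnear (-C)))).and
    ((eventually_gt_atTop 1).and ((tendsto_expProfile ha).eventually_gt_atTop 0)))
  have hT1 : 1 < T := (hT T le_rfl).2.1
  have hT0 : 0 < T := by linarith
  set W := expProfile a with hW
  set d₁ : ℝ → ℝ := fun t ↦ expProfileDeriv t / W t with hd₁
  set d₂ : ℝ → ℝ := fun t ↦ expProfileDeriv₂ t / W t - (expProfileDeriv t / W t) ^ 2 with hd₂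
  have ht1 : ∀ t ≥ T, 1 < t := fun t ht ↦ (hT t ht).2.1
  have hW0 : ∀ t ≥ T, 0 < W t := fun t ht ↦ (hT t ht).2.2
  have hWd : ∀ t ≥ T, HasDerivAt W (expProfileDeriv t) t := fun t ht ↦
    hasDerivAt_expProfile ha (ht1 t ht)
  have hlog : ∀ t ≥ T, HasDerivAt (fun s ↦ Real.log (W s)) (d₁ t) t := fun t ht ↦
    (hWd t ht).log (hW0 t ht).ne'
  have hd₁d : ∀ t ≥ T, HasDerivAt d₁ (d₂ t) t := fun t ht ↦ by
    refine ((hasDerivAt_expProfileDeriv (ht1 t ht)).div (hWd t ht) (hW0 t ht).ne').congr_deriv ?_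
    have := (hW0 t ht).ne'
    simp only [hd₂]
    field_simp
  have hWc : ContinuousOn W (Ici T) := fun t ht ↦ (hWd t ht).continuousAt.continuousWithinAt
  have hd₁c : ContinuousOn d₁ (Ici T) := fun t ht ↦ (hd₁d t ht).continuousAt.continuousWithinAt
  have hd₂c : ContinuousOn d₂ (Ici T) := by
    have hlogc : ContinuousOn Real.log (Ici T) :=
      Real.continuousOn_log.mono fun t ht ↦ (zero_lt_one.trans (ht1 t ht)).ne'
    refine ContinuousOn.sub (ContinuousOn.div ?_ hWc fun t ht ↦ (hW0 t ht).ne') (hd₁c.pow 2)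
    unfold expProfileDeriv₂
    refine ContinuousOn.add (continuousOn_const.div (by fun_prop) fun t ht ↦ ?_)
      (ContinuousOn.div (by fun_prop) (by fun_prop) fun t ht ↦ ?_)
    · have := ht1 t ht
      positivity
    · have := ht1 t ht
      have := Real.log_pos this
      positivity
  -- The nonlinear remainder, with `t` and `x` truncated to the region where it is controlled.
  let N : ℝ → ℝ → ℝ := fun s x ↦
    2 * a * x - Real.exp (-2 * s + W s * Real.exp x) - d₂ s + a * d₁ s
  have hN0 : ∀ s ≥ T, |N s 0| ≤ R / s ^ 2 := fun s hs ↦ by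
    have := (hT s hs).1.1
    rw [← abs_neg] at this
    refine le_trans (le_of_eq ?_) this
    simp only [N, Real.exp_zero, mul_one, hd₁, hd₂]
    congr 1; ring
  have hNl : ∀ s ≥ T, ∀ x ∈ Icc (-C / s ^ 2) (C / s ^ 2), ∀ y ∈ Icc (-C / s ^ 2) (C / s ^ 2),
      |N s x - N s y| ≤ ρ / 2 * |x - y| := by
    intro s hs x hx y hy
    have hd : ∀ z, HasDerivAt (N s)
        (2 * a - Real.exp (-2 * s + W s * Real.exp z) * (W s * Real.exp z)) z := fun z ↦ by
      refine HasDerivAt.congr_deriv (((((hasDerivAt_id z).const_mul (2 * a)).sub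
        (((Real.hasDerivAt_exp z).const_mul (W s)).const_add (-2 * s)).exp).sub_const
          (d₂ s)).add_const (a * d₁ s)) ?_
      ring
    refine (convex_Icc (-C / s ^ 2) (C / s ^ 2)).norm_image_sub_le_of_norm_hasDerivWithin_le
      (fun z _ ↦ (hd z).hasDerivWithinAt) (fun z hz ↦ ?_) hy hx
    have hWs := hW0 s hs
    obtain ⟨⟨-, h₁, h₂⟩, -⟩ := hT s hs
    have m₁ : Real.exp (-2 * s + W s * Real.exp (-C / s ^ 2)) * (W s * Real.exp (-C / s ^ 2)) ≤
        Real.exp (-2 * s + W s * Real.exp z) * (W s * Real.exp z) := by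
      gcongr <;> exact hz.1
    have m₂ : Real.exp (-2 * s + W s * Real.exp z) * (W s * Real.exp z) ≤
        Real.exp (-2 * s + W s * Real.exp (C / s ^ 2)) * (W s * Real.exp (C / s ^ 2)) := by
      gcongr <;> exact hz.2
    rw [abs_lt] at h₁ h₂
    rw [Real.norm_eq_abs, abs_le]
    constructor <;> linarith
  let σ : ℝ → ℝ := fun s ↦ max T s
  have hσ : ∀ s, T ≤ σ s := fun s ↦ le_max_left _ _
  have hσ0 : ∀ s, 0 < σ s := fun s ↦ hT0.trans_le (hσ s)
  have hσc : Continuous σ := by fun_prop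
  let p : ℝ → ℝ := fun s ↦ C / σ s ^ 2
  have hp0 : ∀ s, 0 < p s := fun s ↦ div_pos hC0 (pow_pos (hσ0 s) 2)
  have hpc : Continuous p := continuous_const.div (hσc.pow 2) fun s ↦ (pow_pos (hσ0 s) 2).ne'
  let κ : ℝ → ℝ → ℝ := fun s x ↦ max (-p s) (min (p s) x)
  have hκ : ∀ s x, κ s x ∈ Icc (-C / σ s ^ 2) (C / σ s ^ 2) := fun s x ↦ by
    rw [neg_div]
    exact ⟨le_max_left _ _, max_le (by linarith [hp0 s]) (min_le_left _ _)⟩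
  have hκl : ∀ s x y, |κ s x - κ s y| ≤ |x - y| := fun s x y ↦ abs_max_min_sub_le _ _ _ _
  have hκp : ∀ s x, |κ s x| ≤ p s := fun s x ↦
    abs_le.2 ⟨le_max_left _ _, (hκ s x).2⟩
  have hlipG : ∀ s x y, |N (σ s) (κ s x) - N (σ s) (κ s y)| ≤ ρ / 2 * |x - y| := fun s x y ↦
    (hNl (σ s) (hσ s) _ (hκ s x) _ (hκ s y)).trans 
      (mul_le_mul_of_nonneg_left (hκl s x y) (half_pos hρ).le)
  obtain ⟨η, ν, hην⟩ := hsol (fun s x ↦ N (σ s) (κ s x)) p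
    (by
      have c : ∀ {f : ℝ → ℝ}, ContinuousOn f (Ici T) → Continuous fun z : ℝ × ℝ ↦ f (σ z.1) :=
        fun hf ↦ hf.comp_continuous (by fun_prop) fun z ↦ hσ z.1
      have c₁ := c hWc
      have c₂ := c hd₁c
      have c₃ := c hd₂c
      have cp : Continuous fun z : ℝ × ℝ ↦ p z.1 := hpc.comp continuous_fst
      have cκ : Continuous fun z : ℝ × ℝ ↦ κ z.1 z.2 := by
        simp only [κ]; fun_prop
      exact ((((cκ.const_mul (2 * a)).sub
        (((hσc.comp continuous_fst).const_mul (-2)).add (c₁.mul cκ.rexp)).rexp).sub c₃).add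
          (c₂.const_mul a)))
    (fun s t hst ↦ by
      have : σ s ≤ σ t := max_le_max le_rfl hst
      have := hσ0 s
      simp only [p]
      gcongr)
    ⟨C / T ^ 2, by
      rintro _ ⟨s, rfl⟩
      have := hσ s
      simp only [p]
      gcongr⟩
    (fun s x ↦ by
      have h0 : (0 : ℝ) ∈ Icc (-C / σ s ^ 2) (C / σ s ^ 2) := by
        rw [neg_div]; exact ⟨by linarith [hp0 s], (hp0 s).le⟩
      have h1 := hNl (σ s) (hσ s) _ (hκ s x) 0 h0
      have h2 := hN0 (σ s) (hσ s)
      have h3 : R / σ s ^ 2 = ρ / 2 * p s := by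
        simp only [p]; rw [← mul_div_assoc]; congr 1; linarith
      have h4 : ρ / 2 * |κ s x - 0| ≤ ρ / 2 * p s := by
        rw [sub_zero]; gcongr; exact hκp s x
      have h5 := abs_sub_abs_le_abs_sub (N (σ s) (κ s x)) (N (σ s) 0)
      linarith)
    hlipG
  refine ⟨T, hT0, C, hC0, fun t ↦ Real.log (W t) + η t, fun t ↦ d₁ t + ν t, fun t ht ↦ ?_⟩
  obtain ⟨h1, h2, h3⟩ := hην t
  have hσt : σ t = t := max_eq_right ht
  have hκt : κ t (η t) = η t := by
    obtain ⟨h4, h5⟩ := abs_le.1 h3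
    simp only [κ]
    rw [min_eq_right h5, max_eq_right h4]
  refine ⟨(hlog t ht).add h1, ((hd₁d t ht).add h2).congr_deriv ?_, ?_⟩
  · rw [hκt, hσt]
    simp only [N]
    rw [Real.exp_add (Real.log (W t)), Real.exp_log (hW0 t ht)]
    ring
  · rw [add_sub_cancel_left]
    simpa only [p, hσt] using h3

/-- Any solution tending to `+∞` is strictly increasing. -/
lemma deriv_pos_of_tendsto_atTop {a T : ℝ} {w v : ℝ → ℝ} (hw : ∀ t ≥ T, HasDerivAt w (v t) t)
    (hv : ∀ t ≥ T, HasDerivAt v (a * v t - Real.exp (-2 * t + Real.exp (w t))) t)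
    (hlim : Tendsto w atTop atTop) : ∀ t ≥ T, 0 < v t := by
  intro t₀ ht₀
  by_contra! h0
  have hy : ∀ t ≥ T, HasDerivAt (fun s ↦ Real.exp (-a * s) * v s)
      (-(Real.exp (-a * t) * Real.exp (-2 * t + Real.exp (w t)))) t := fun t ht ↦ by
    have e : HasDerivAt (fun s ↦ Real.exp (-a * s)) (Real.exp (-a * t) * (-a * 1)) t :=
      ((hasDerivAt_id t).const_mul (-a)).exp
    refine (e.mul (hv t ht)).congr_deriv ?_
    ring
  have hya : AntitoneOn (fun s ↦ Real.exp (-a * s) * v s) (Ici t₀) :=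
    antitoneOn_of_hasDerivWithinAt_nonpos (convex_Ici t₀)
      (fun t ht ↦ (hy t (ht₀.trans ht)).continuousAt.continuousWithinAt)
      (fun t ht ↦ (hy t (ht₀.trans (interior_subset ht))).hasDerivWithinAt)
      (fun t _ ↦ neg_nonpos.2 (by positivity))
  have hv0 : ∀ t ≥ t₀, v t ≤ 0 := fun t ht ↦ by
    have h1 : Real.exp (-a * t) * v t ≤ Real.exp (-a * t₀) * v t₀ := hya self_mem_Ici ht ht
    have h2 := mul_nonpos_of_nonneg_of_nonpos (Real.exp_pos (-a * t₀)).le h0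
    by_contra! h3
    have := mul_pos (Real.exp_pos (-a * t)) h3
    linarith
  have hwa : AntitoneOn w (Ici t₀) :=
    antitoneOn_of_hasDerivWithinAt_nonpos (convex_Ici t₀)
      (fun t ht ↦ (hw t (ht₀.trans ht)).continuousAt.continuousWithinAt)
      (fun t ht ↦ (hw t (ht₀.trans (interior_subset ht))).hasDerivWithinAt)
      (fun t ht ↦ hv0 t (interior_subset ht))
  obtain ⟨t, h1, h2⟩ := ((hlim.eventually_gt_atTop (w t₀)).and (eventually_ge_atTop t₀)).exists
  exact absurd (hwa self_mem_Ici h2 h2) (not_le.2 h1)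

/-- existence of a singular-solution profile `w` for the ODE
`w'' - (n-2) w' + exp(-2t + e^w) = 0` with `w(T*) = 0`, `w > 0` on `(T*, ∞)`,
and `w(t) = ln(2t + φ(t)) + O(1/t²)` as `t → ∞`, where
`φ(t) = ln((n-2)/t) + ln(1 + (ln t)/(2t))`. -/
theorem singular_solution_exp_exp (n : ℕ) (hn : 3 ≤ n) :
    ∃ (Tstar : ℝ) (w : ℝ → ℝ),
      ContinuousOn w (Set.Ici Tstar) ∧
      ContDiffOn ℝ 2 w (Set.Ioi Tstar) ∧
      (∀ t > Tstar,
        deriv (deriv w) t - ((n : ℝ) - 2) * deriv w t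
            + Real.exp (-2 * t + Real.exp (w t)) = 0 ∧ 0 < w t) ∧
      w Tstar = 0 ∧
      ∃ C > (0 : ℝ), ∃ T > (0 : ℝ), ∀ t > T,
        |w t - Real.log (2 * t +
            (Real.log (((n : ℝ) - 2) / t) + Real.log (1 + Real.log t / (2 * t))))|
          ≤ C / t ^ 2 := by
  have hn' : (3 : ℝ) ≤ n := by exact_mod_cast hn
  set a : ℝ := (n : ℝ) - 2 with ha_def
  have ha : 0 < a := by linarith
  obtain ⟨T, hT, C, hC, g, g', hg⟩ := exists_solution_near_infinity ha
  have hglim : Tendsto g atTop atTop := by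
    have h1 : Tendsto (fun t ↦ Real.log (expProfile a t) + -C) atTop atTop :=
      tendsto_atTop_add_const_right _ _ (Real.tendsto_log_atTop.comp (tendsto_expProfile ha))
    refine tendsto_atTop_mono' _ ?_ h1
    filter_upwards [eventually_ge_atTop (max T 1)] with t ht
    have h2 := (abs_le.1 (hg t ((le_max_left _ _).trans ht)).2.2).1
    have h3 : C / t ^ 2 ≤ C :=
      div_le_self hC.le (one_le_pow₀ ((le_max_right _ _).trans ht))
    linarith
  have hg'0 := deriv_pos_of_tendsto_atTop (fun t ht ↦ (hg t ht).1) (fun t ht ↦ (hg t ht).2.1) hglim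
  obtain ⟨B, hgB, hTB⟩ := ((hglim.eventually_gt_atTop 0).and (eventually_ge_atTop T)).exists
  obtain ⟨A, hAB, f, f', hfA, hfB, hf'B, hfpos, hf⟩ :=
    exists_backward_solution (B := B) ha hgB (hg'0 B hTB)
  have hgmono : StrictMonoOn g (Ici T) := strictMonoOn_of_hasDerivWithinAt_pos (convex_Ici T)
    (fun t ht ↦ (hg t ht).1.continuousAt.continuousWithinAt)
    (fun t ht ↦ (hg t (interior_subset ht)).1.hasDerivWithinAt)
    (fun t ht ↦ hg'0 t (interior_subset ht))
  set w : ℝ → ℝ := fun t ↦ if t ≤ B then f t else g t with hw_def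
  set v : ℝ → ℝ := fun t ↦ if t ≤ B then f' t else g' t with hv_def
  have hw : ∀ t > A, HasDerivAt w (v t) t := fun t ht ↦
    hasDerivAt_ite_le hfB hf'B (fun t ht ↦ (hf t ht).1) (fun t ht ↦ (hg t (hTB.trans ht)).1) ht
  have hv : ∀ t > A, HasDerivAt v (a * v t - Real.exp (-2 * t + Real.exp (w t))) t := by
    intro t ht
    refine (hasDerivAt_ite_le hf'B (by rw [hf'B, hfB]) (fun t ht ↦ (hf t ht).2)
      (fun t ht ↦ (hg t (hTB.trans ht)).2.1) ht).congr_deriv ?_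
    simp only [hw_def, hv_def]
    split_ifs <;> rfl
  have hdw : EqOn (deriv w) v (Ioi A) := fun t ht ↦ (hw t ht).deriv
  have hddw : ∀ t > A, deriv (deriv w) t = a * v t - Real.exp (-2 * t + Real.exp (w t)) :=
    fun t ht ↦ by
      rw [(hdw.eventuallyEq_of_mem (Ioi_mem_nhds ht)).deriv_eq, (hv t ht).deriv]
  have hwc : ContinuousOn w (Ioi A) := fun t ht ↦ (hw t ht).continuousAt.continuousWithinAt
  have hvc : ContinuousOn v (Ioi A) := fun t ht ↦ (hv t ht).continuousAt.continuousWithinAt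
  refine ⟨A, w, fun t ht ↦ ?_, ?_, fun t ht ↦ ⟨?_, ?_⟩, ?_, C, hC, max B T,
    lt_max_of_lt_right hT, fun t ht ↦ ?_⟩
  · rcases (mem_Ici.1 ht).eq_or_lt with rfl | ht
    · have h : ContinuousWithinAt w (Icc A B) A :=
        (hf A ⟨le_rfl, hAB.le⟩).1.continuousWithinAt.congr (fun s hs ↦ if_pos hs.2)
          (if_pos hAB.le)
      exact h.mono_of_mem_nhdsWithin (Icc_mem_nhdsGE hAB)
    · exact (hw t ht).continuousAt.continuousWithinAt
  · have hv1 : ContDiffOn ℝ 1 v (Ioi A) := by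
      rw [← zero_add (1 : WithTop ℕ∞), contDiffOn_succ_iff_deriv_of_isOpen isOpen_Ioi]
      refine ⟨fun t ht ↦ (hv t ht).differentiableAt.differentiableWithinAt, by simp, ?_⟩
      rw [contDiffOn_zero]
      refine ContinuousOn.congr ?_ fun t ht ↦ (hv t ht).deriv
      fun_prop
    rw [← one_add_one_eq_two, contDiffOn_succ_iff_deriv_of_isOpen isOpen_Ioi]
    exact ⟨fun t ht ↦ (hw t ht).differentiableAt.differentiableWithinAt, by simp, hv1.congr hdw⟩
  · rw [hddw t ht, hdw ht]; ring
  · by_cases h : t ≤ B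
    · simpa only [hw_def, if_pos h] using hfpos t ⟨ht, h⟩
    · simp only [hw_def, if_neg h]
      exact hgB.trans (hgmono hTB (hTB.trans (not_le.1 h).le) (not_le.1 h))
  · simpa only [hw_def, if_pos hAB.le] using hfA
  · have h := (hg t ((le_max_right _ _).trans ht.le)).2.2
    simp only [hw_def, if_neg (not_le.2 ((le_max_left _ _).trans_lt ht))]
    exact h
end

section
/- Let n ≥ 3, φ(t) = ln((n−2)/t) + ln(1 + (ln t)/(2t)), and f(t) = ln(2t + φ(t)) for t > 0 large. Then e^{φ(t)} − (n−2)·f'(t) = O(1/t²) as t → ∞. -/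
/-- The derivative of `log (2 t + log (a / t) + log (1 + log t / (2 t)))`. -/
theorem hasDerivAt_log_two_mul_add {a t : ℝ} (ha : 1 ≤ a) (ht : 0 < t) (hL : 0 ≤ Real.log t)
    (hD : 2 * t + (Real.log (a / t) + Real.log (1 + Real.log t / (2 * t))) ≠ 0) :
    HasDerivAt
      (fun s => Real.log (2 * s + (Real.log (a / s) + Real.log (1 + Real.log s / (2 * s)))))
      ((2 + (-1 / t + (1 - Real.log t) / (t * (2 * t + Real.log t)))) /
        (2 * t + (Real.log (a / t) + Real.log (1 + Real.log t / (2 * t))))) t := by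
  have hu : 1 + Real.log t / (2 * t) ≠ 0 := by positivity
  have hat : a / t ≠ 0 := by positivity
  have hw : 2 * t + Real.log t ≠ 0 := by positivity
  have h2 : HasDerivAt (fun s : ℝ => 2 * s) 2 t := by
    simpa using (hasDerivAt_id t).const_mul 2
  have hinv : HasDerivAt (fun s : ℝ => a / s) (-a / t ^ 2) t :=
    ((hasDerivAt_const t a).div (hasDerivAt_id t) ht.ne').congr_deriv (by simp)
  have hquot := (((Real.hasDerivAt_log ht.ne').div h2 (by positivity)).const_add 1).log hu
  have h := (h2.add ((hinv.log hat).add hquot)).log hD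
  refine h.congr_deriv ?_
  simp only [Pi.add_apply, Pi.div_apply]
  congr 2
  have hu' : 1 + Real.log t / (2 * t) = (2 * t + Real.log t) / (2 * t) := by
    field_simp
  rw [hu']
  have ha0 : a ≠ 0 := by positivity
  field_simp

/-- The pointwise estimate behind the asymptotics, with an explicit constant. -/
theorem abs_exp_sub_mul_deriv_le {a t : ℝ} (ha : 1 ≤ a) (ht : 0 < t) (hL : 1 ≤ Real.log t)
    (hLt : Real.log t ^ 2 ≤ t) :
    |Real.exp (Real.log (a / t) + Real.log (1 + Real.log t / (2 * t))) -
        a * deriv (fun s => Real.log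
          (2 * s + (Real.log (a / s) + Real.log (1 + Real.log s / (2 * s))))) t| ≤
      a * (3 * Real.log a + 8) / t ^ 2 := by
  have hc : 0 ≤ Real.log a := Real.log_nonneg ha
  have ha0 : 0 < a := by linarith
  have hat : 0 < a / t := by positivity
  have hu0 : 0 ≤ Real.log t / (2 * t) := by positivity
  have hlt : Real.log t ≤ t := by nlinarith
  have hu1 : Real.log t / (2 * t) ≤ 1 := by
    rw [div_le_one (by positivity)]; linarith
  have hv0 : 0 ≤ Real.log (1 + Real.log t / (2 * t)) := Real.log_nonneg (by linarith)
  have hv1 : Real.log (1 + Real.log t / (2 * t)) ≤ 1 := by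
    have := Real.log_le_sub_one_of_pos (x := 1 + Real.log t / (2 * t)) (by linarith)
    linarith
  have hφ : Real.log (a / t) = Real.log a - Real.log t := Real.log_div ha0.ne' ht.ne'
  have hDt : t ≤ 2 * t + (Real.log (a / t) + Real.log (1 + Real.log t / (2 * t))) := by
    rw [hφ]; linarith
  have hD0 := ht.trans_le hDt
  rw [(hasDerivAt_log_two_mul_add ha ht (by linarith) hD0.ne').deriv,
    Real.exp_add, Real.exp_log hat, Real.exp_log (by linarith)]
  set D := 2 * t + (Real.log (a / t) + Real.log (1 + Real.log t / (2 * t))) with hD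
  rw [hφ] at hD
  generalize Real.log (1 + Real.log t / (2 * t)) = v at *
  generalize Real.log a = c at *
  generalize Real.log t = L at *
  have hw : 0 < 2 * t + L := by linarith
  set q := (L - 1) / (2 * t + L) with hq
  have hq0 : 0 ≤ q := div_nonneg (by linarith) hw.le
  have hq1 : q ≤ 1 := by rw [hq, div_le_one hw]; linarith
  have key : a / t * (1 + L / (2 * t)) - a * ((2 + (-1 / t + (1 - L) / (t * (2 * t + L)))) / D) =
      a * (2 * t * (c + v) + L * (c - L + v) + 2 * t + 2 * t * q) / (2 * t ^ 2 * D) := by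
    have hqe : (1 - L) / (t * (2 * t + L)) = -q / t := by
      rw [hq]; field_simp; ring
    rw [hqe]
    clear_value q
    field_simp
    rw [hD]
    ring
  have hN : |2 * t * (c + v) + L * (c - L + v) + 2 * t + 2 * t * q| ≤ (3 * c + 8) * t := by
    have h1 := mul_nonneg ht.le hv0
    have h2 := mul_le_mul_of_nonneg_left hv1 ht.le
    have h3 := mul_nonneg ht.le hq0
    have h4 := mul_le_mul_of_nonneg_left hq1 ht.le
    have h5 := mul_nonneg ht.le hc
    have h6 : 0 ≤ L * c := by positivity
    have h7 := mul_le_mul_of_nonneg_right hlt hc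
    have h8 : 0 ≤ L * v := by positivity
    have h9 : L * v ≤ L * 1 := by gcongr
    rw [abs_le]
    constructor <;> nlinarith
  rw [key, abs_div, abs_mul, abs_of_pos ha0, abs_of_pos (show 0 < 2 * t ^ 2 * D by positivity),
    div_le_div_iff₀ (by positivity) (by positivity)]
  calc a * |2 * t * (c + v) + L * (c - L + v) + 2 * t + 2 * t * q| * t ^ 2
      ≤ a * ((3 * c + 8) * t) * t ^ 2 := by gcongr
    _ = a * (3 * c + 8) * (t ^ 2 * t) := by ring
    _ ≤ a * (3 * c + 8) * (2 * t ^ 2 * D) := by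
      gcongr
      nlinarith [sq_nonneg t]


/-- for `φ(t) = ln((n-2)/t) + ln(1 + (ln t)/(2t))` and
`f(t) = ln(2t + φ(t))`, one has `e^{φ(t)} - (n-2) f'(t) = O(1/t²)` as `t → ∞`. -/
theorem exp_phi_minus_f_deriv (n : ℕ) (hn : 3 ≤ n) :
    let φ : ℝ → ℝ := fun t =>
      Real.log (((n : ℝ) - 2) / t) + Real.log (1 + Real.log t / (2 * t))
    let f : ℝ → ℝ := fun t => Real.log (2 * t + φ t)
    ∃ C > (0 : ℝ), ∃ T > (0 : ℝ), ∀ t > T,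
      |Real.exp (φ t) - ((n : ℝ) - 2) * deriv f t| ≤ C / t ^ 2 := by
  intro φ f
  have ha : (1 : ℝ) ≤ (n : ℝ) - 2 := by
    have : (3 : ℝ) ≤ n := by exact_mod_cast hn
    linarith
  have hev : ∀ᶠ t : ℝ in Filter.atTop, 1 ≤ Real.log t ∧ Real.log t ^ 2 ≤ t := by
    filter_upwards [Real.tendsto_log_atTop.eventually_ge_atTop 1,
      (Real.isLittleO_pow_log_id_atTop (n := 2)).bound one_pos,
      Filter.eventually_ge_atTop 0] with t h1 h2 h3
    refine ⟨h1, ?_⟩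
    simpa [abs_of_nonneg h3] using h2
  obtain ⟨T, hT⟩ := Filter.eventually_atTop.1 hev
  have hc := Real.log_nonneg ha
  refine ⟨((n : ℝ) - 2) * (3 * Real.log ((n : ℝ) - 2) + 8), by positivity,
    max T 1, by positivity, fun t ht => ?_⟩
  obtain ⟨hL, hLt⟩ := hT t ((le_max_left _ _).trans ht.le)
  exact abs_exp_sub_mul_deriv_le ha (by linarith [le_max_right T 1]) hL hLt
end

section
/- Let n ≥ 3, φ(t) = ln((n−2)/t) + ln(1 + (ln t)/(2t)), and w(t) = ln(2t + φ(t)) + η(t) for t large, where η(t) = O(1/t²) as t → ∞. Then lim_{t→∞} e^{−2t} · exp( w(t) + exp(w(t)) ) = 2(n−2). -/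
open Filter Topology in
theorem tendsto_one_add_log_div_two_mul :
    Tendsto (fun t : ℝ => 1 + Real.log t / (2 * t)) atTop (𝓝 1) := by
  have h := (Real.isLittleO_log_id_atTop.tendsto_div_nhds_zero.const_mul (1 / 2)).const_add 1
  simp only [id, mul_zero, add_zero] at h
  refine h.congr fun t => ?_
  rw [← div_div]
  ring

open Filter Topology in
theorem tendsto_two_mul_add_log_div_self {c : ℝ} (hc : 0 < c) :
    Tendsto (fun t : ℝ => (2 * t + (Real.log (c / t) + Real.log (1 + Real.log t / (2 * t)))) / t)
      atTop (𝓝 2) := by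
  have hlog : Tendsto (fun t : ℝ => Real.log t / t) atTop (𝓝 0) :=
    Real.isLittleO_log_id_atTop.tendsto_div_nhds_zero
  have hc' : Tendsto (fun t : ℝ => Real.log c / t) atTop (𝓝 0) :=
    tendsto_const_nhds.div_atTop tendsto_id
  have ha : Tendsto (fun t : ℝ => Real.log (1 + Real.log t / (2 * t)) / t) atTop (𝓝 0) :=
    (tendsto_one_add_log_div_two_mul.log one_ne_zero).div_atTop tendsto_id
  have h := ((hc'.sub hlog).add ha).const_add 2
  simp only [sub_zero, add_zero] at h
  refine h.congr' ?_
  filter_upwards [eventually_gt_atTop 0] with t ht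
  rw [Real.log_div hc.ne' ht.ne']
  field_simp

open Filter Topology in
theorem tendsto_mul_of_abs_le_div_sq {η : ℝ → ℝ} {C T : ℝ} (h : ∀ t > T, |η t| ≤ C / t ^ 2) :
    Tendsto (fun t => t * η t) atTop (𝓝 0) := by
  refine squeeze_zero_norm' (a := fun t => C / t) ?_ (tendsto_const_nhds.div_atTop tendsto_id)
  filter_upwards [eventually_gt_atTop T, eventually_gt_atTop 0] with t hT ht
  rw [Real.norm_eq_abs, abs_mul, abs_of_pos ht]
  calc t * |η t| ≤ t * (C / t ^ 2) := mul_le_mul_of_nonneg_left (h t hT) ht.le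
    _ = C / t := by field_simp

open Filter Topology in
theorem tendsto_zero_of_tendsto_mul_self {η : ℝ → ℝ}
    (h : Tendsto (fun t => t * η t) atTop (𝓝 0)) : Tendsto η atTop (𝓝 0) := by
  refine (h.div_atTop tendsto_id).congr' ?_
  filter_upwards [eventually_gt_atTop 0] with t ht
  exact mul_div_cancel_left₀ _ ht.ne'

open Filter Topology in
theorem tendsto_mul_exp_sub_one {η : ℝ → ℝ} (h : Tendsto (fun t => t * η t) atTop (𝓝 0)) :
    Tendsto (fun t => t * (Real.exp (η t) - 1)) atTop (𝓝 0) := by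
  have hη := (tendsto_zero_of_tendsto_mul_self h).abs
  have h2 := h.abs.const_mul 2
  simp only [abs_zero, mul_zero] at hη h2
  refine squeeze_zero_norm' ?_ h2
  filter_upwards [hη.eventually_le_const one_pos] with t ht
  rw [Real.norm_eq_abs, abs_mul, abs_mul]
  nlinarith [mul_le_mul_of_nonneg_left (Real.abs_exp_sub_one_le ht) (abs_nonneg t)]

/-- if `w(t) = ln(2t + φ(t)) + η(t)` with `η(t) = O(1/t²)`, where
`φ(t) = ln((n-2)/t) + ln(1 + (ln t)/(2t))`, then
`lim_{t→∞} e^{-2t} exp( w(t) + e^{w(t)} ) = 2(n-2)`. -/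
theorem limit_x_star (n : ℕ) (hn : 3 ≤ n) (T : ℝ) (w η : ℝ → ℝ)
    (hw : ∀ t > T, w t = Real.log (2 * t +
        (Real.log (((n : ℝ) - 2) / t) + Real.log (1 + Real.log t / (2 * t)))) + η t)
    (hη : ∃ C > (0 : ℝ), ∃ T' > (0 : ℝ), ∀ t > T', |η t| ≤ C / t ^ 2) :
    Filter.Tendsto
      (fun t : ℝ => Real.exp (-2 * t) * Real.exp (w t + Real.exp (w t)))
      Filter.atTop (nhds (2 * ((n : ℝ) - 2))) := by
  obtain ⟨C, -, T', -, hη⟩ := hη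
  have hc : (0 : ℝ) < (n : ℝ) - 2 := by
    have : (3 : ℝ) ≤ n := by exact_mod_cast hn
    linarith
  have htη := tendsto_mul_of_abs_le_div_sq hη
  have hexp := (tendsto_zero_of_tendsto_mul_self htη).rexp
  have hL := tendsto_two_mul_add_log_div_self hc
  have ha := tendsto_one_add_log_div_two_mul
  have hlim := (((hL.mul_const ((n : ℝ) - 2)).mul ha).mul hexp).mul
    (hL.mul (tendsto_mul_exp_sub_one htη)).rexp
  simp only [mul_zero, Real.exp_zero, mul_one] at hlim
  refine hlim.congr' ?_
  filter_upwards [Filter.eventually_gt_atTop T, Filter.eventually_gt_atTop 0,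
    hL.eventually_const_lt two_pos, ha.eventually_const_lt one_pos] with t hT ht hLt hat
  rw [hw t hT]
  have hφ : Real.exp (Real.log (((n : ℝ) - 2) / t) + Real.log (1 + Real.log t / (2 * t))) =
      ((n : ℝ) - 2) / t * (1 + Real.log t / (2 * t)) := by
    rw [Real.exp_add, Real.exp_log (div_pos hc ht), Real.exp_log hat]
  set a := 1 + Real.log t / (2 * t)
  set φ := Real.log (((n : ℝ) - 2) / t) + Real.log a
  have hLpos : 0 < 2 * t + φ := (div_pos_iff_of_pos_right ht).1 hLt
  have hw' : Real.exp (Real.log (2 * t + φ) + η t) = (2 * t + φ) * Real.exp (η t) := by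
    rw [Real.exp_add, Real.exp_log hLpos]
  have hsplit : (2 * t + φ) * Real.exp (η t) =
      2 * t + φ + (2 * t + φ) / t * (t * (Real.exp (η t) - 1)) := by
    field_simp
    ring
  rw [Real.exp_add (Real.log (2 * t + φ) + η t), hw', hsplit, Real.exp_add (2 * t + φ),
    Real.exp_add (2 * t), hφ, ← hsplit, neg_mul, Real.exp_neg]
  field_simp
end
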